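/- arXiv:2403.13492 — 7 statements merged into one kernel-verified Lean document; each statement's English description precedes it below -/
import Mathlib

section
/- Let xs : List α and ds : List ℕ have the same length k, with every entry of ds strictly positive, and let m = sum of ds. For 0 ≤ i < k let p_i = ∑_{j<i} ds[j] (so 0 = p_0 < p_1 < ⋯ < p_{k−1} < m). Define ys : List (Option α) of length m by ys[q] = some xs[i] if q = p_i for some i, and ys[q] = none otherwise. Define op : Option α → Option α → Option α by op x y = y if y ≠ none and op x y = x otherwise. Then the list whose q-th entry (0 ≤ q < m) is the fold of op with initial value none over the first q+1 entries of ys equals the list ((xs.zip ds).flatMap (fun (x, d) => List.replicate d x)).map some. -/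
/-- The expansion of `xs` with multiplicities `ds` has length `ds.sum`. -/
theorem length_expansion {α : Type*} (xs : List α) (ds : List ℕ)
    (hlen : xs.length = ds.length) :
    ((xs.zip ds).flatMap (fun pr => List.replicate pr.2 pr.1)).length = ds.sum := by
  induction xs generalizing ds with
  | nil => cases ds <;> simp_all
  | cons x xs ih =>
    cases ds with
    | nil => simp at hlen
    | cons d ds =>
      have := ih ds (by simpa using hlen)
      simp_all

/-- The block of `xs[i]` in the expansion starts at the `i`-th prefix sum of the degrees. -/
theorem getElem?_expansion_start {α : Type*} (xs : List α) (ds : List ℕ)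
    (hlen : xs.length = ds.length) (hpos : ∀ d ∈ ds, 0 < d) (i : ℕ) (hi : i < xs.length) :
    ((xs.zip ds).flatMap (fun pr => List.replicate pr.2 pr.1))[(ds.take i).sum]? =
      some xs[i] := by
  induction xs generalizing ds i with
  | nil => simp at hi
  | cons x xs ih =>
    cases ds with
    | nil => simp at hlen
    | cons d ds =>
      have hd : 0 < d := hpos d (by simp)
      cases i with
      | zero => simp [hd]
      | succ i =>
        have := ih ds (by simpa using hlen) (fun e he => hpos e (by simp [he])) i
          (by simpa using hi)
        simpa [List.getElem?_append] using this

/-- Consecutive entries of the expansion agree unless the second one starts a block. -/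
theorem getElem?_expansion_succ {α : Type*} (xs : List α) (ds : List ℕ)
    (hlen : xs.length = ds.length) (q : ℕ) (hq : q + 1 < ds.sum)
    (hmiss : ∀ i < xs.length, q + 1 ≠ (ds.take i).sum) :
    ((xs.zip ds).flatMap (fun pr => List.replicate pr.2 pr.1))[q + 1]? =
      ((xs.zip ds).flatMap (fun pr => List.replicate pr.2 pr.1))[q]? := by
  induction xs generalizing ds q with
  | nil => simp
  | cons x xs ih =>
    cases ds with
    | nil => simp at hlen
    | cons d ds =>
      simp only [List.length_cons, Nat.add_right_cancel_iff] at hlen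
      simp only [List.sum_cons] at hq
      rcases lt_trichotomy (q + 1) d with h | h | h
      · simp [List.getElem?_append, h, Nat.lt_of_succ_lt h]
      · have hne : 0 < xs.length := by
          rcases Nat.eq_zero_or_pos xs.length with h0 | h0
          · have : ds = [] := List.length_eq_zero_iff.mp (by omega)
            simp [this] at hq
            omega
          · exact h0
        exact absurd h (by simpa using hmiss 1 (by simpa using hne))
      · obtain ⟨r, rfl⟩ : ∃ r, q = d + r := ⟨q - d, by omega⟩
        have := ih ds hlen r (by omega) (fun i hi heq =>
          hmiss (i + 1) (by simpa using hi) (by simp; omega))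
        simpa [List.getElem?_append, add_assoc] using this


/-- Correctness of the expansion primitive: scattering each
`xs[i]` to position `p i = ∑_{j<i} ds[j]` of an `m = ds.sum` array (all other
positions dummy/`none`) and running prefix-copy yields the expansion in which
each `xs[i]` is repeated `ds[i]` times, in order. -/
theorem expansion_via_prefix_copy {α : Type*}
    (xs : List α) (ds : List ℕ)
    (hlen : xs.length = ds.length)
    (hpos : ∀ d ∈ ds, 0 < d)
    (p : ℕ → ℕ) (hp : ∀ i, p i = (ds.take i).sum)
    (ys : List (Option α))
    (hys_len : ys.length = ds.sum)
    (hhit : ∀ (i : ℕ) (hi : i < xs.length), ys[p i]? = some (some (xs[i]'hi)))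
    (hmiss : ∀ q < ds.sum, (∀ i < xs.length, q ≠ p i) → ys[q]? = some none)
    (op : Option α → Option α → Option α)
    (hop : ∀ x y, op x y = if y.isNone then x else y) :
    (List.range ds.sum).map (fun q => (ys.take (q + 1)).foldl op none)
      = ((xs.zip ds).flatMap (fun pr => List.replicate pr.2 pr.1)).map some := by
  set L := (xs.zip ds).flatMap (fun pr => List.replicate pr.2 pr.1) with hL
  have hLlen : L.length = ds.sum := length_expansion xs ds hlen
  have key : ∀ q < ds.sum, (ys.take (q + 1)).foldl op none = L[q]? := by
    intro q
    induction q using Nat.strong_induction_on with | _ q ih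
    intro hq
    have step : (ys.take (q + 1)).foldl op none =
        op ((ys.take q).foldl op none) (ys[q]'(hys_len ▸ hq)) := by
      rw [List.take_succ_eq_append_getElem (hys_len ▸ hq), List.foldl_append]
      rfl
    have hget : ys[q]? = some (ys[q]'(hys_len ▸ hq)) := List.getElem?_eq_getElem _
    by_cases hex : ∃ i, i < xs.length ∧ q = p i
    · obtain ⟨i, hi, hqi⟩ := hex
      have hstart : L[q]? = some xs[i] := by
        rw [hqi, hp]
        exact getElem?_expansion_start xs ds hlen hpos i hi
      have hval : ys[q]'(hys_len ▸ hq) = some xs[i] :=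
        Option.some.inj (hget.symm.trans (hqi ▸ hhit i hi))
      rw [step, hval, hop, hstart]
      simp
    · have hne : ∀ i < xs.length, q ≠ p i := fun i hi h => hex ⟨i, hi, h⟩
      have hval : ys[q]'(hys_len ▸ hq) = none :=
        Option.some.inj (hget.symm.trans (hmiss q hq hne))
      rw [step, hval, hop]
      cases q with
      | zero =>
        have hxs : 0 < xs.length := by
          rw [hlen, List.length_pos_iff]
          rintro rfl
          simp at hq
        exact absurd (by simp [hp]) (hne 0 hxs)
      | succ q =>
        rw [hL, getElem?_expansion_succ xs ds hlen q hq (fun i hi => hp i ▸ hne i hi)]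
        exact ih q (Nat.lt_succ_self q) (Nat.lt_of_succ_lt hq)
  apply List.ext_getElem
  · simp [hLlen]
  · intro q h₁ h₂
    have hq : q < ds.sum := by simpa using h₁
    simp [key q hq, hLlen, hq]
end

section
/- Let ds : List ℕ have length k, and let m ≥ sum of ds. For 0 ≤ i < k define p_i = 1 + ∑_{j<i} ds[j] if ds[i] > 0, and p_i = m + i + 1 if ds[i] = 0. Then the map i ↦ p_i is injective, i.e., all positions p_0, …, p_{k−1} are pairwise distinct. -/
theorem List.sum_take_add_getD_le_sum_take (l : List ℕ) {i j : ℕ} (hij : i < j) :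
    (l.take i).sum + l.getD i 0 ≤ (l.take j).sum := by
  induction l generalizing i j with
  | nil => simp
  | cons a l ih =>
    obtain ⟨j, rfl⟩ := Nat.exists_eq_add_of_lt (Nat.zero_lt_of_lt hij)
    cases i with
    | zero => simp
    | succ i =>
      have h := ih (i := i) (j := j) (by omega)
      simp only [Nat.zero_add, List.take_succ_cons, List.sum_cons, List.getD_cons_succ]
      omega

/-- In the expansion primitive extended to zero degrees,
the scatter positions `p i = 1 + ∑_{j<i} ds[j]` (when `ds[i] > 0`) and
`p i = m + i + 1` (when `ds[i] = 0`) are pairwise distinct. -/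
theorem expansion_positions_injective
    (ds : List ℕ) (m : ℕ) (hm : ds.sum ≤ m)
    (p : ℕ → ℕ)
    (hp : ∀ i < ds.length,
      p i = if 0 < ds.getD i 0 then 1 + (ds.take i).sum else m + i + 1) :
    ∀ i < ds.length, ∀ j < ds.length, p i = p j → i = j := by
  intro i hi j hj h
  rw [hp i hi, hp j hj] at h
  have hi' := ds.sum_take_add_getD_le_sum_take hi
  have hj' := ds.sum_take_add_getD_le_sum_take hj
  rw [List.take_length] at hi' hj'
  rcases lt_trichotomy i j with hij | hij | hij
  · have := ds.sum_take_add_getD_le_sum_take hij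
    split_ifs at h <;> omega
  · exact hij
  · have := ds.sum_take_add_getD_le_sum_take hij
    split_ifs at h <;> omega
end

section
/- Let (𝒮, ⊕, ⊗) be a commutative semiring, let R : Finset α and S : Finset β with key functions f : α → K and g : β → K (K with decidable equality), and let v_R : α → 𝒮 and v_S : β → 𝒮 be annotations. Then ∑_{(r,s) ∈ R × S, f r = g s} v_R(r) ⊗ v_S(s) = ∑_{k ∈ (R.image f) ∪ (S.image g)} ( ∑_{r ∈ R, f r = k} v_R(r) ) ⊗ ( ∑_{s ∈ S, g s = k} v_S(s) ), where ∑ denotes iterated ⊕. -/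
/-- Correctness of the reduce step of the Yannakakis
algorithm over annotated relations: the `⊕`-aggregate over the annotated join
`R ⋈^⊗ S` equals the sum over join-key values of the product of the per-key
aggregates of the two relations. -/
theorem annotated_join_aggregate {α β K 𝒮 : Type*}
    [DecidableEq α] [DecidableEq β] [DecidableEq K] [CommSemiring 𝒮]
    (R : Finset α) (S : Finset β) (f : α → K) (g : β → K)
    (vR : α → 𝒮) (vS : β → 𝒮) :
    ∑ p ∈ (R ×ˢ S).filter (fun p => f p.1 = g p.2), vR p.1 * vS p.2
      = ∑ k ∈ R.image f ∪ S.image g,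
          (∑ r ∈ R.filter (fun r => f r = k), vR r) *
            (∑ s ∈ S.filter (fun s => g s = k), vS s) := by
  have hmaps : ∀ p ∈ (R ×ˢ S).filter (fun p => f p.1 = g p.2),
      f p.1 ∈ R.image f ∪ S.image g := fun p hp =>
    Finset.mem_union_left _ <| Finset.mem_image_of_mem f
      (Finset.mem_product.mp (Finset.mem_filter.mp hp).1).1
  rw [← Finset.sum_fiberwise_of_maps_to hmaps]
  refine Finset.sum_congr rfl fun k _ => ?_
  rw [Finset.sum_mul_sum, ← Finset.sum_product']
  refine Finset.sum_congr ?_ fun _ _ => rfl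
  ext ⟨r, s⟩
  simp only [Finset.mem_filter, Finset.mem_product]
  grind
end

section
/- Let R : Finset α and S : Finset β with key functions f : α → K and g : β → K (K with decidable equality), and define the join J = {(r, s) ∈ R × S : f r = g s}. If R contains no dangling tuples with respect to S, i.e., for every r ∈ R there exists s ∈ S with g s = f r, then |R| ≤ |J|. -/
/-- If `R` has no dangling tuples with respect to `S`
(every tuple of `R` joins with at least one tuple of `S`), then the join of
`R` and `S` has at least `|R|` tuples. -/
theorem no_dangling_join_size_ge {α β K : Type*}
    [DecidableEq α] [DecidableEq β] [DecidableEq K]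
    (R : Finset α) (S : Finset β) (f : α → K) (g : β → K)
    (hnd : ∀ r ∈ R, ∃ s ∈ S, g s = f r) :
    R.card ≤ ((R ×ˢ S).filter (fun p => f p.1 = g p.2)).card := by
  refine Finset.card_le_card_of_surjOn Prod.fst fun r hr => ?_
  obtain ⟨s, hs, hsr⟩ := hnd r hr
  exact ⟨(r, s), Finset.mem_filter.2 ⟨Finset.mk_mem_product hr hs, hsr.symm⟩, rfl⟩
end

section
/- Let R : Finset α, S : Finset β, T : Finset γ with key functions f : α → K, g₁ : β → K, g₂ : β → K', h : γ → K' (K, K' with decidable equality). Define J₂ = {(r, s) ∈ R × S : f r = g₁ s} and J₃ = {(r, s, t) ∈ R × S × T : f r = g₁ s and g₂ s = h t}. If every pair of J₂ is non-dangling with respect to T, i.e., for every (r, s) ∈ J₂ there exists t ∈ T with h t = g₂ s, then |J₂| ≤ |J₃|. -/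
/-- For the path join `R ⋈ S ⋈ T`: if every tuple of the
intermediate join `J₂ = R ⋈ S` is non-dangling with respect to `T`, then the
intermediate join size is bounded by the final join size, `|J₂| ≤ |J₃|`. -/
theorem intermediate_join_size_le_final {α β γ K K' : Type*}
    [DecidableEq α] [DecidableEq β] [DecidableEq γ]
    [DecidableEq K] [DecidableEq K']
    (R : Finset α) (S : Finset β) (T : Finset γ)
    (f : α → K) (g₁ : β → K) (g₂ : β → K') (h : γ → K')
    (hnd : ∀ p ∈ (R ×ˢ S).filter (fun p => f p.1 = g₁ p.2),
      ∃ t ∈ T, h t = g₂ p.2) :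
    ((R ×ˢ S).filter (fun p => f p.1 = g₁ p.2)).card
      ≤ ((R ×ˢ S ×ˢ T).filter
          (fun p => f p.1 = g₁ p.2.1 ∧ g₂ p.2.1 = h p.2.2)).card := by
  refine Finset.card_le_card_of_surjOn (fun q => (q.1, q.2.1)) ?_
  rintro ⟨r, s⟩ hp
  obtain ⟨t, ht, hts⟩ := hnd (r, s) hp
  simp only [Finset.coe_filter, Finset.mem_product, Set.mem_ofPred_eq] at hp
  refine ⟨(r, s, t), ?_, rfl⟩
  simp only [Finset.coe_filter, Finset.mem_product, Set.mem_ofPred_eq]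
  exact ⟨⟨hp.1.1, hp.1.2, ht⟩, hp.2, hts.symm⟩
end

section
/- Let n ∈ ℕ and t : Fin n → Bool (t i = true meaning position i is marked), and let c = |{j : t j = true}|. Define f : Fin n → ℕ by f i = |{j : j ≤ i and t j = true}| if t i = true, and f i = c + |{j : j ≤ i and t j = false}| if t i = false. Then (1) f is injective and its image is exactly {1, 2, …, n}; (2) every marked index is mapped into {1, …, c} and every unmarked index into {c+1, …, n}; and (3) f is strictly monotone both on the set of marked indices and on the set of unmarked indices, so the relative order of the marked elements (and of the unmarked elements) is preserved. -/
open Finset in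
/-- The number of elements up to `i` satisfying `p` is positive and bounded by the total count,
when `i` itself satisfies `p`. -/
theorem card_filter_le_and_mem_Icc {α : Type*} [Fintype α] [LinearOrder α]
    (p : α → Prop) [DecidablePred p] {i : α} (hi : p i) :
    #{j | j ≤ i ∧ p j} ∈ Icc 1 #{j | p j} := by
  rw [mem_Icc]
  refine ⟨card_pos.mpr ⟨i, by simp [hi]⟩, card_le_card fun j hj => ?_⟩
  simp only [mem_filter] at hj ⊢
  exact ⟨hj.1, hj.2.2⟩

open Finset in
/-- The number of elements up to `i` satisfying `p` strictly increases when passing to a later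
element satisfying `p`. -/
theorem card_filter_le_and_lt {α : Type*} [Fintype α] [LinearOrder α]
    (p : α → Prop) [DecidablePred p] {i j : α} (hj : p j) (hij : i < j) :
    #{k | k ≤ i ∧ p k} < #{k | k ≤ j ∧ p k} := by
  refine card_lt_card <| (ssubset_iff_of_subset fun k hk => ?_).mpr
    ⟨j, by simp [hj], by simp [hij]⟩
  simp only [mem_filter] at hk ⊢
  exact ⟨hk.1, hk.2.1.trans hij.le, hk.2.2⟩

/-- The prefix-sum destination map of the compaction
primitive is a permutation onto `{1,…,n}` sending marked indices to
`{1,…,c}` and unmarked ones to `{c+1,…,n}`, preserving the relative order of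
the marked indices and of the unmarked indices. -/
theorem compaction_destination_map (n : ℕ) (t : Fin n → Bool)
    (c : ℕ) (hc : c = (Finset.univ.filter (fun j : Fin n => t j = true)).card)
    (f : Fin n → ℕ)
    (hf : ∀ i : Fin n,
      f i =
        if t i then
          (Finset.univ.filter (fun j : Fin n => j ≤ i ∧ t j = true)).card
        else
          c + (Finset.univ.filter (fun j : Fin n => j ≤ i ∧ t j = false)).card) :
    Function.Injective f ∧
    Finset.image f Finset.univ = Finset.Icc 1 n ∧
    (∀ i : Fin n, t i = true → f i ∈ Finset.Icc 1 c) ∧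
    (∀ i : Fin n, t i = false → f i ∈ Finset.Icc (c + 1) n) ∧
    (∀ i j : Fin n, t i = true → t j = true → i < j → f i < f j) ∧
    (∀ i j : Fin n, t i = false → t j = false → i < j → f i < f j) := by
  have hcard : c + (Finset.univ.filter (fun j : Fin n => t j = false)).card = n := by
    have h := Finset.card_filter_add_card_filter_not (s := Finset.univ)
      (fun j : Fin n => t j = true)
    simp only [Bool.not_eq_true, Finset.card_univ, Fintype.card_fin] at h
    rw [hc, h]
  have marked_mem : ∀ i : Fin n, t i = true → f i ∈ Finset.Icc 1 c := by
    intro i hi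
    rw [hf i, if_pos hi, hc]
    exact card_filter_le_and_mem_Icc (fun j => t j = true) hi
  have unmarked_mem : ∀ i : Fin n, t i = false → f i ∈ Finset.Icc (c + 1) n := by
    intro i hi
    have h := card_filter_le_and_mem_Icc (fun j => t j = false) hi
    rw [hf i, if_neg (by simp [hi])]
    rw [Finset.mem_Icc] at h ⊢
    omega
  have marked_lt : ∀ i j : Fin n, t i = true → t j = true → i < j → f i < f j := by
    intro i j hi hj hij
    rw [hf i, hf j, if_pos hi, if_pos hj]
    exact card_filter_le_and_lt (fun j => t j = true) hj hij
  have unmarked_lt : ∀ i j : Fin n, t i = false → t j = false → i < j → f i < f j := by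
    intro i j hi hj hij
    rw [hf i, hf j, if_neg (by simp [hi]), if_neg (by simp [hj])]
    exact Nat.add_lt_add_left (card_filter_le_and_lt (fun j => t j = false) hj hij) c
  have ne_of_lt : ∀ i j : Fin n, i < j → f i ≠ f j := by
    intro i j hij
    cases hi : t i <;> cases hj : t j
    · exact (unmarked_lt i j hi hj hij).ne
    · have h₁ := Finset.mem_Icc.mp (unmarked_mem i hi)
      have h₂ := Finset.mem_Icc.mp (marked_mem j hj)
      omega
    · have h₁ := Finset.mem_Icc.mp (marked_mem i hi)
      have h₂ := Finset.mem_Icc.mp (unmarked_mem j hj)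
      omega
    · exact (marked_lt i j hi hj hij).ne
  have inj : Function.Injective f := Function.Injective.of_lt_imp_ne ne_of_lt
  refine ⟨inj, ?_, marked_mem, unmarked_mem, marked_lt, unmarked_lt⟩
  refine Finset.eq_of_subset_of_card_le (Finset.image_subset_iff.mpr fun i _ => ?_) ?_
  · rw [Finset.mem_Icc]
    cases hi : t i
    · have h := Finset.mem_Icc.mp (unmarked_mem i hi)
      omega
    · have h := Finset.mem_Icc.mp (marked_mem i hi)
      omega
  · simp [Finset.card_image_of_injective _ inj]
end

section
/- Let (𝒮, ⊕, ⊗) be a commutative semiring, let R : Finset α, S : Finset β, T : Finset γ with key functions f : α → K, g₁ : β → K, g₂ : β → K', h : γ → K' (K, K' with decidable equality), and annotations v_R : α → 𝒮, v_S : β → 𝒮, v_T : γ → 𝒮. Then ∑_{(r,s,t) ∈ R × S × T, f r = g₁ s and g₂ s = h t} v_R(r) ⊗ v_S(s) ⊗ v_T(t) = ∑_{s ∈ S} ( ∑_{r ∈ R, f r = g₁ s} v_R(r) ) ⊗ v_S(s) ⊗ ( ∑_{t ∈ T, h t = g₂ s} v_T(t) ), where ∑ denotes iterated ⊕. -/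
/-- Correctness of the reduce step of the Yannakakis
algorithm for the path join `R ⋈ S ⋈ T` rooted at `S`, over a commutative
semiring of annotations: the total `⊕`-aggregate of the `⊗`-annotations of
the three-way join equals the sum over `s ∈ S` of the per-key aggregate of
`R` times `v_S(s)` times the per-key aggregate of `T`. -/
theorem yannakakis_reduce_path_join {α β γ K K' 𝒮 : Type*}
    [DecidableEq α] [DecidableEq β] [DecidableEq γ]
    [DecidableEq K] [DecidableEq K'] [CommSemiring 𝒮]
    (R : Finset α) (S : Finset β) (T : Finset γ)
    (f : α → K) (g₁ : β → K) (g₂ : β → K') (h : γ → K')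
    (vR : α → 𝒮) (vS : β → 𝒮) (vT : γ → 𝒮) :
    ∑ p ∈ (R ×ˢ S ×ˢ T).filter
        (fun p => f p.1 = g₁ p.2.1 ∧ g₂ p.2.1 = h p.2.2),
      vR p.1 * vS p.2.1 * vT p.2.2
      = ∑ s ∈ S,
          (∑ r ∈ R.filter (fun r => f r = g₁ s), vR r) * vS s *
            (∑ t ∈ T.filter (fun t => h t = g₂ s), vT t) := by
  simp only [Finset.sum_filter, Finset.sum_product, Finset.sum_mul, Finset.mul_sum]
  rw [Finset.sum_comm]
  refine Finset.sum_congr rfl fun s _ => ?_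
  rw [Finset.sum_comm]
  refine Finset.sum_congr rfl fun t _ => Finset.sum_congr rfl fun r _ => ?_
  by_cases hr : f r = g₁ s <;> by_cases ht : h t = g₂ s <;> simp [hr, ht, eq_comm (a := g₂ s)]
end
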